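/- Let k ≥ 0 be a fixed integer, and for each n let X_n be a homogeneous and spatially independent random subcomplex of Δₙ with parameter q_k^{(n)}. If n^{k+1}·q_k^{(n)} → ∞ as n → ∞, then for every real r ∈ [1,∞), lim_{n→∞} E[ | f_k(X_n)/(n^{k+1} q_k^{(n)}) − 1/(k+1)! |^r ] = 0. In particular, lim_{n→∞} P(f_k(X_n) > 0) = 1. -/

import Mathlib

open MeasureTheory Finset Filter


/-- A (sub)complex of the complete complex on the vertex type `V`:
a family of finite subsets closed under taking subsets and containing `∅`. -/
def SComplex {V : Type*} [DecidableEq V] (Y : Finset (Finset V)) : Prop :=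
  ∅ ∈ Y ∧ ∀ σ ∈ Y, ∀ τ ∈ σ.powerset, τ ∈ Y

instance {V : Type*} [DecidableEq V] :
    DecidablePred (fun Y : Finset (Finset V) => SComplex Y) :=
  fun Y => decidable_of_iff (∅ ∈ Y ∧ ∀ σ ∈ Y, ∀ τ ∈ σ.powerset, τ ∈ Y) Iff.rfl

/-- `scount Y m` = number of simplices of `Y` with `m` vertices (i.e. `(m-1)`-simplices);
`f_k(Y) = scount Y (k+1)` and `f_{-1}(Y) = scount Y 0`. -/
def scount {V : Type*} (Y : Finset (Finset V)) (m : ℕ) : ℕ :=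
  (Y.filter (fun σ => σ.card = m)).card

/-- Number of external `i`-simplices of `Y` in the complete complex on `Fin n`:
`i`-simplices `σ ∉ Y` all of whose strict subsets lie in `Y`. -/
def ecount {n : ℕ} (Y : Finset (Finset (Fin n))) (i : ℕ) : ℕ :=
  (Finset.univ.filter (fun σ : Finset (Fin n) =>
    σ.card = i + 1 ∧ σ ∉ Y ∧ ∀ τ ∈ σ.powerset, τ ≠ σ → τ ∈ Y)).card

/-- The weight `∏_{i=0}^{n-1} p_i^{f_i(Y)} (1-p_i)^{e_i(Y)}` of the
multi-parameter random simplicial complex model. -/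
noncomputable def mpWeight {n : ℕ} (p : Fin n → ℝ) (Y : Finset (Finset (Fin n))) : ℝ :=
  ∏ i : Fin n, p i ^ scount Y (i.1 + 1) * (1 - p i) ^ ecount Y i.1

/-- The probability of an event, as a real number. -/
noncomputable def prb {Ω : Type*} [MeasurableSpace Ω] (μ : Measure Ω) (A : Set Ω) : ℝ :=
  (μ A).toReal

/-- Conditional probability `P(A | B)`, as a real number. -/
noncomputable def condP {Ω : Type*} [MeasurableSpace Ω] (μ : Measure Ω) (A B : Set Ω) : ℝ :=
  prb μ (A ∩ B) / prb μ B

/-- A random subcomplex is homogeneous if its distribution is invariant under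
every permutation of the vertices. -/
def Homogeneous {n : ℕ} {Ω : Type*} [MeasurableSpace Ω] (μ : Measure Ω)
    (X : Ω → Finset (Finset (Fin n))) : Prop :=
  ∀ (g : Equiv.Perm (Fin n)) (Y : Finset (Finset (Fin n))),
    prb μ {ω | Finset.image (fun σ => σ.image (⇑g)) (X ω) = Y} = prb μ {ω | X ω = Y}

/-- Spatial independence of a random subcomplex. -/
def SpatInd {n : ℕ} {Ω : Type*} [MeasurableSpace Ω] (μ : Measure Ω)
    (X : Ω → Finset (Finset (Fin n))) : Prop :=
  ∀ Y₁ Y₂ : Finset (Finset (Fin n)), SComplex Y₁ → SComplex Y₂ →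
    prb μ {ω | Y₁ ∪ Y₂ ⊆ X ω} * prb μ {ω | Y₁ ∩ Y₂ ⊆ X ω} =
      prb μ {ω | Y₁ ⊆ X ω} * prb μ {ω | Y₂ ⊆ X ω}

/-- The `k`-dimensional standard simplex `{0, 1, …, k}` in `Fin n`
(for `k = -1` this is the empty simplex). -/
def stdSimp (n : ℕ) (k : ℤ) : Finset (Fin n) :=
  Finset.univ.filter (fun v => (v : ℤ) ≤ k)

/-- The `k`-dimensional simplex `{1, 2, …, k+1}` in `Fin n`,
sharing `k` vertices with `stdSimp n k`. -/
def stdSimp' (n : ℕ) (k : ℕ) : Finset (Fin n) :=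
  Finset.univ.filter (fun v => 1 ≤ (v : ℕ) ∧ (v : ℕ) ≤ k + 1)

/-- The parameter `q_k = P(τ ∈ X)` for a `k`-simplex `τ` (with `q_{-1} = 1`). -/
noncomputable def qpar {n : ℕ} {Ω : Type*} [MeasurableSpace Ω] (μ : Measure Ω)
    (X : Ω → Finset (Finset (Fin n))) (k : ℤ) : ℝ :=
  if k < 0 then 1 else prb μ {ω | stdSimp n k ∈ X ω}

/-- The parameter `r_k = P(σ ∈ X | τ ∈ X)` for a `(k+1)`-simplex `σ` containing the
`k`-simplex `τ`, if `q_k > 0`, and `0` otherwise (with `r_{-1} = q_0`). -/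
noncomputable def rpar {n : ℕ} {Ω : Type*} [MeasurableSpace Ω] (μ : Measure Ω)
    (X : Ω → Finset (Finset (Fin n))) (k : ℤ) : ℝ :=
  if 0 < qpar μ X k then
    condP μ {ω | stdSimp n (k + 1) ∈ X ω} {ω | stdSimp n k ∈ X ω}
  else 0

/-- The parameter `s_k = P(τ₁ ∪ τ₂ ∈ X | τ₁ ∈ X, τ₂ ∈ X)` for `k`-simplices `τ₁, τ₂`
sharing `k` vertices, if `P(τ₁ ∈ X, τ₂ ∈ X) > 0`, and `0` otherwise. -/
noncomputable def spar {n : ℕ} {Ω : Type*} [MeasurableSpace Ω] (μ : Measure Ω)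
    (X : Ω → Finset (Finset (Fin n))) (k : ℕ) : ℝ :=
  if 0 < prb μ ({ω | stdSimp n k ∈ X ω} ∩ {ω | stdSimp' n k ∈ X ω}) then
    condP μ {ω | stdSimp n (k + 1) ∈ X ω}
      ({ω | stdSimp n k ∈ X ω} ∩ {ω | stdSimp' n k ∈ X ω})
  else 0


/-- Finite-weight description of a random complex. -/
structure GoodW (n : ℕ) (p : Finset (Finset (Fin n)) → ℝ) (P : Finset (Finset (Fin n)) → ℝ) : Prop where
  nonneg : ∀ Y, 0 ≤ p Y
  sum_one : ∑ Y, p Y = 1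
  supp : ∀ Y, ¬ SComplex Y → p Y = 0
  hom : ∀ (g : Equiv.Perm (Fin n)) Y, p (Finset.image (fun σ => σ.image (⇑g)) Y) = p Y
  hP : ∀ A, P A = ∑ Y, if A ⊆ Y then p Y else 0
  si : ∀ A B, SComplex A → SComplex B → P (A ∪ B) * P (A ∩ B) = P A * P B

namespace GoodW
variable {n : ℕ} {p P : Finset (Finset (Fin n)) → ℝ}

lemma P_nonneg (h : GoodW n p P) (A) : 0 ≤ P A := by
  rw [h.hP]
  exact Finset.sum_nonneg fun Y _ => by split_ifs <;> simp [h.nonneg]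

lemma P_anti (h : GoodW n p P) {A B} (hAB : A ⊆ B) : P B ≤ P A := by
  rw [h.hP, h.hP]
  refine Finset.sum_le_sum fun Y _ => ?_
  by_cases hB : B ⊆ Y
  · simp [hB, hAB.trans hB]
  · simp only [hB, if_false]; split_ifs <;> simp [h.nonneg]

lemma sc_powerset (σ : Finset (Fin n)) : SComplex σ.powerset := by
  refine ⟨by simp, fun a ha b hb => ?_⟩
  simp only [Finset.mem_powerset] at *
  exact hb.trans ha

lemma sc_union {A B : Finset (Finset (Fin n))} (hA : SComplex A) (hB : SComplex B) :
    SComplex (A ∪ B) := by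
  refine ⟨by simp [hA.1], fun a ha b hb => ?_⟩
  rcases Finset.mem_union.1 ha with h | h
  · exact Finset.mem_union_left _ (hA.2 a h b hb)
  · exact Finset.mem_union_right _ (hB.2 a h b hb)

lemma sub_iff {Y : Finset (Finset (Fin n))} (hY : SComplex Y) (σ : Finset (Fin n)) :
    σ.powerset ⊆ Y ↔ σ ∈ Y :=
  ⟨fun h => h (by simp), fun h τ hτ => hY.2 σ h τ hτ⟩

lemma P_empty (h : GoodW n p P) : P (Finset.powerset ∅) = 1 := by
  rw [h.hP, ← h.sum_one]
  refine Finset.sum_congr rfl fun Y _ => ?_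
  by_cases hY : SComplex Y
  · rw [if_pos]; rw [sub_iff hY]; exact hY.1
  · rw [h.supp Y hY]; simp

lemma exists_perm (σ τ : Finset (Fin n)) (hc : σ.card = τ.card) :
    ∃ g : Equiv.Perm (Fin n), σ.image g = τ := by
  let e : {x // x ∈ σ} ≃ {x // x ∈ τ} := Finset.equivOfCardEq hc
  refine ⟨e.extendSubtype, ?_⟩
  apply Finset.eq_of_subset_of_card_le
  · intro x hx
    obtain ⟨y, hy, rfl⟩ := Finset.mem_image.1 hx
    exact e.extendSubtype_mem y hy
  · rw [Finset.card_image_of_injective _ (Equiv.injective _), hc]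

lemma P_hom (h : GoodW n p P) (σ τ : Finset (Fin n)) (hc : σ.card = τ.card) :
    P σ.powerset = P τ.powerset := by
  obtain ⟨g, rfl⟩ := exists_perm σ τ hc
  have key : ∀ ρ : Finset (Fin n), P ρ.powerset = ∑ Y, if ρ ∈ Y then p Y else 0 := by
    intro ρ
    rw [h.hP]
    refine Finset.sum_congr rfl fun Y _ => ?_
    by_cases hY : SComplex Y
    · simp only [sub_iff hY]
    · rw [h.supp Y hY]; simp
  have hi : Function.Injective (fun σ : Finset (Fin n) => σ.image (⇑g)) :=
    Finset.image_injective g.injective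
  have hi2 := Finset.image_injective hi
  rw [key, key]
  refine Fintype.sum_bijective _ (Finite.injective_iff_bijective.1 hi2) _ _ fun Y => ?_
  rw [h.hom]
  congr 1
  exact propext (hi.mem_finset_image (s := Y) (a := σ)).symm

/-- probability of a simplex with j vertices -/
def Qj (P : Finset (Finset (Fin n)) → ℝ) (j : ℕ) : ℝ := P (stdSimp n ((j : ℤ) - 1)).powerset

lemma card_std {j : ℕ} (hj : j ≤ n) : (stdSimp n ((j : ℤ) - 1)).card = j := by
  unfold stdSimp
  have : (Finset.univ.filter (fun v : Fin n => ((v : ℕ) : ℤ) ≤ (j : ℤ) - 1))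
      = Finset.univ.filter (fun v : Fin n => (v : ℕ) < j) := by
    ext v; simp
  rw [this, Fin.card_filter_val_lt]
  omega

lemma P_eq (h : GoodW n p P) (σ : Finset (Fin n)) : P σ.powerset = Qj P σ.card :=
  h.P_hom _ _ (card_std (by simpa using Finset.card_le_univ σ)).symm

lemma Q_nonneg (h : GoodW n p P) (j) : 0 ≤ Qj P j := h.P_nonneg _

lemma Q_zero (h : GoodW n p P) : Qj P 0 = 1 := by
  rw [← h.P_empty, h.P_eq]; simp

lemma Q_anti (h : GoodW n p P) {i j} (hij : i ≤ j) : Qj P j ≤ Qj P i := by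
  refine h.P_anti (Finset.powerset_mono.2 fun v => ?_)
  simp [stdSimp]; omega

lemma Q_concave (h : GoodW n p P) {j} (hj : j + 2 ≤ n) :
    Qj P (j + 2) * Qj P j ≤ Qj P (j + 1) ^ 2 := by
  obtain ⟨U, hU, hUc⟩ := Finset.exists_subset_card_eq (s := (Finset.univ : Finset (Fin n))) (n := j + 2) (by simpa)
  obtain ⟨a, ha, b, hb, hab⟩ := Finset.one_lt_card.1 (show 1 < U.card by omega)
  have hA : (U.erase a).card = j + 1 := by rw [Finset.card_erase_of_mem ha]; omega
  have hB : (U.erase b).card = j + 1 := by rw [Finset.card_erase_of_mem hb]; omega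
  have hI : ((U.erase a) ∩ (U.erase b)).card = j := by
    have : (U.erase a) ∩ (U.erase b) = (U.erase a).erase b := by ext; simp; tauto
    rw [this, Finset.card_erase_of_mem (by simp [hb, hab.symm])]; omega
  have h1 := h.si _ _ (sc_powerset (U.erase a)) (sc_powerset (U.erase b))
  rw [show (U.erase a).powerset ∩ (U.erase b).powerset = ((U.erase a) ∩ (U.erase b)).powerset by
    ext x; simp only [Finset.mem_inter, Finset.mem_powerset, Finset.subset_inter_iff], h.P_eq, h.P_eq, h.P_eq, hA, hB, hI] at h1
  have h2 : P U.powerset ≤ P ((U.erase a).powerset ∪ (U.erase b).powerset) :=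
    h.P_anti (Finset.union_subset (Finset.powerset_mono.2 (Finset.erase_subset _ _))
      (Finset.powerset_mono.2 (Finset.erase_subset _ _)))
  rw [h.P_eq, hUc] at h2
  rw [pow_two, ← h1]
  exact mul_le_mul_of_nonneg_right h2 (h.Q_nonneg j)

lemma Q_step (h : GoodW n p P) (j : ℕ) (hj : j + 1 ≤ n) :
    Qj P (j + 1) ^ j ≤ Qj P j ^ (j + 1) := by
  induction j with
  | zero => simp [h.Q_zero]
  | succ j ih =>
    have ih := ih (by omega)
    have hc := h.Q_concave (j := j) (by omega)
    rcases (h.Q_nonneg (j+1)).eq_or_lt with h0 | h0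
    · have : Qj P (j+2) = 0 := le_antisymm (h0 ▸ h.Q_anti (by omega)) (h.Q_nonneg _)
      rw [show j + 1 + 1 = j + 2 from rfl, this, ← h0]; simp
    · have h1 : (Qj P (j + 2) * Qj P j) ^ (j+1) ≤ (Qj P (j + 1) ^ 2) ^ (j+1) :=
        pow_le_pow_left₀ (mul_nonneg (h.Q_nonneg _) (h.Q_nonneg _)) hc _
      rw [mul_pow] at h1
      have h2 : Qj P (j+2) ^ (j+1) * Qj P (j+1) ^ j ≤ Qj P (j+1) ^ (j+1+1) * Qj P (j+1) ^ j :=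
        calc _ ≤ Qj P (j+2) ^ (j+1) * Qj P j ^ (j+1) :=
              mul_le_mul_of_nonneg_left ih (pow_nonneg (h.Q_nonneg _) _)
          _ ≤ _ := h1
          _ = _ := by ring
      exact le_of_mul_le_mul_right h2 (pow_pos h0 _)

lemma Q_pow (h : GoodW n p P) (l m : ℕ) (hl : l ≤ m) (hm : m ≤ n) :
    Qj P m ^ l ≤ Qj P l ^ m := by
  induction m, hl using Nat.le_induction with
  | base => exact le_rfl
  | succ m hlm ih =>
    rcases Nat.eq_zero_or_pos m with rfl | hm0
    · obtain rfl : l = 0 := by omega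
      simp [h.Q_zero]
    have ih := ih (by omega)
    have h1 : (Qj P (m+1) ^ l) ^ m ≤ (Qj P l ^ (m+1)) ^ m := by
      calc (Qj P (m+1) ^ l) ^ m = (Qj P (m+1) ^ m) ^ l := by rw [← pow_mul, ← pow_mul, mul_comm]
        _ ≤ (Qj P m ^ (m+1)) ^ l := pow_le_pow_left₀ (pow_nonneg (h.Q_nonneg _) _) (h.Q_step m hm) _
        _ = (Qj P m ^ l) ^ (m+1) := by rw [← pow_mul, ← pow_mul, mul_comm]
        _ ≤ (Qj P l ^ m) ^ (m+1) := pow_le_pow_left₀ (pow_nonneg (h.Q_nonneg _) _) ih _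
        _ = _ := by rw [← pow_mul, ← pow_mul, mul_comm]
    exact le_of_pow_le_pow_left₀ (by omega) (pow_nonneg (h.Q_nonneg _) _) h1

/-- lower bound for `n^l Q_l`. -/
lemma nQ_lower (h : GoodW n p P) (k l : ℕ) (hk : k + 1 ≤ n) (hl1 : 1 ≤ l) (hl : l ≤ k + 1) {s : ℝ}
    (hs1 : 1 ≤ s) (hs : s ^ (k+1) = (n:ℝ)^(k+1) * Qj P (k+1)) :
    s ≤ (n:ℝ)^l * Qj P l := by
  refine le_of_pow_le_pow_left₀ (n := k+1) (by omega) (mul_nonneg (by positivity) (h.Q_nonneg _)) ?_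
  calc s ^ (k+1) ≤ (s ^ (k+1)) ^ l := le_self_pow₀ (one_le_pow₀ hs1) (by omega)
    _ = ((n:ℝ)^l)^(k+1) * (Qj P (k+1)) ^ l := by rw [hs, mul_pow, ← pow_mul, ← pow_mul, mul_comm l]
    _ ≤ ((n:ℝ)^l)^(k+1) * (Qj P l) ^ (k+1) :=
        mul_le_mul_of_nonneg_left (h.Q_pow l (k+1) hl hk) (by positivity)
    _ = _ := by rw [mul_pow]

lemma count_le (V : Finset (Fin n)) (k l : ℕ) (hl : l ≤ k + 1) :
    (((Finset.univ.powersetCard (k+1)).filter (fun σ : Finset (Fin n) => (σ ∩ V).card = l)).card : ℝ)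
      ≤ 2 ^ V.card * (n:ℝ) ^ (k + 1 - l) := by
  have : ((Finset.univ.powersetCard (k+1)).filter (fun σ : Finset (Fin n) => (σ ∩ V).card = l)).card
      ≤ (V.powerset ×ˢ (Finset.univ : Finset (Fin n)).powersetCard (k+1-l)).card := by
    refine Finset.card_le_card_of_injOn (fun σ => (σ ∩ V, σ \ V)) ?_ ?_
    · intro σ hσ
      simp only [Finset.coe_filter, Finset.mem_powersetCard, Set.mem_ofPred_eq] at hσ
      simp only [Finset.coe_product, Set.mem_prod, Finset.mem_coe, Finset.mem_powerset, Finset.mem_powersetCard]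
      refine ⟨Finset.inter_subset_right, Finset.subset_univ _, ?_⟩
      have := Finset.card_inter_add_card_sdiff σ V
      omega
    · intro a _ b _ hab
      simp only [Prod.mk.injEq] at hab
      rw [← Finset.sdiff_union_inter a V, ← Finset.sdiff_union_inter b V, hab.1, hab.2]
  rw [Finset.card_product, Finset.card_powerset, Finset.card_powersetCard, Finset.card_univ, Fintype.card_fin] at this
  calc _ ≤ (((2 ^ V.card * n.choose (k+1-l) : ℕ)) : ℝ) := by exact_mod_cast this
    _ ≤ _ := by
      push_cast
      gcongr
      exact_mod_cast Nat.choose_le_pow _ _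

lemma sum_inv_le (h : GoodW n p P) (k M : ℕ) (hk : k + 1 ≤ n) (V : Finset (Fin n)) (hV : V.card ≤ M)
    {s : ℝ} (hs1 : 1 ≤ s) (hs : s ^ (k+1) = (n:ℝ)^(k+1) * Qj P (k+1)) :
    ∑ σ ∈ (Finset.univ : Finset (Fin n)).powersetCard (k+1), 1 / Qj P (σ ∩ V).card
      ≤ (n:ℝ)^(k+1) * (1 / (Nat.factorial (k+1) : ℝ) + (k+1) * 2 ^ M / s) := by
  have hn : (0:ℝ) < n := by exact_mod_cast (by omega : 0 < n)
  have hs0 : 0 < s := by linarith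
  have hmaps : ∀ σ ∈ (Finset.univ : Finset (Fin n)).powersetCard (k+1),
      (σ ∩ V).card ∈ Finset.range (k+2) := by
    intro σ hσ
    have := Finset.card_le_card (Finset.inter_subset_left (s₁ := σ) (s₂ := V))
    simp only [Finset.mem_powersetCard] at hσ
    simp; omega
  rw [← Finset.sum_fiberwise_of_maps_to hmaps, Finset.sum_range_succ']
  have hsum : ∀ l, ∑ σ ∈ ((Finset.univ : Finset (Fin n)).powersetCard (k+1)).filter (fun σ => (σ ∩ V).card = l), 1 / Qj P (σ ∩ V).card
     = (((Finset.univ.powersetCard (k+1)).filter (fun σ : Finset (Fin n) => (σ ∩ V).card = l)).card : ℝ) * (1 / Qj P l) := by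
    intro l
    rw [← nsmul_eq_mul]
    refine Finset.sum_eq_card_nsmul fun σ hσ => ?_
    rw [(Finset.mem_filter.1 hσ).2]
  simp only [hsum]
  have h0 : (((Finset.univ.powersetCard (k+1)).filter (fun σ : Finset (Fin n) => (σ ∩ V).card = 0)).card : ℝ) * (1 / Qj P 0)
      ≤ (n:ℝ)^(k+1) * (1 / (Nat.factorial (k+1) : ℝ)) := by
    rw [h.Q_zero]
    have h1 := Finset.card_filter_le ((Finset.univ : Finset (Fin n)).powersetCard (k+1)) (fun σ => (σ ∩ V).card = 0)
    rw [Finset.card_powersetCard, Finset.card_univ, Fintype.card_fin] at h1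
    have h2 := Nat.choose_le_pow_div (α := ℝ) (k+1) n
    have h3 : (((Finset.univ.powersetCard (k+1)).filter (fun σ : Finset (Fin n) => (σ ∩ V).card = 0)).card : ℝ) ≤ (n.choose (k+1) : ℝ) := by exact_mod_cast h1
    rw [mul_one_div, mul_one_div, div_one]
    linarith
  have h1 : ∀ l ∈ Finset.range (k+1), (((Finset.univ.powersetCard (k+1)).filter (fun σ : Finset (Fin n) => (σ ∩ V).card = l+1)).card : ℝ) * (1 / Qj P (l+1))
      ≤ (n:ℝ)^(k+1) * (2 ^ M / s) := by
    intro l hl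
    have hl := Finset.mem_range.1 hl
    have a1 := count_le V k (l+1) (by omega)
    have a2 := h.nQ_lower k (l+1) hk (by omega) (by omega) hs1 hs
    have hQ : 0 < Qj P (l+1) := by
      have := hs0.trans_le a2
      exact (pos_iff_pos_of_mul_pos this).1 (by positivity)
    have a3 : (2:ℝ) ^ V.card ≤ 2 ^ M := pow_le_pow_right₀ (by norm_num) hV
    calc _ ≤ (2 ^ V.card * (n:ℝ) ^ (k + 1 - (l+1))) * (1 / Qj P (l+1)) :=
          mul_le_mul_of_nonneg_right a1 (by positivity)
      _ ≤ (2 ^ M * (n:ℝ) ^ (k + 1 - (l+1))) * (1 / Qj P (l+1)) := by gcongr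
      _ = (n:ℝ)^(k+1) * (2 ^ M / ((n:ℝ)^(l+1) * Qj P (l+1))) := by
          rw [show (n:ℝ)^(k+1) = (n:ℝ)^(k+1-(l+1)) * (n:ℝ)^(l+1) by rw [← pow_add]; congr 1; omega]
          field_simp
      _ ≤ _ := by gcongr
  have h2 := Finset.sum_le_card_nsmul _ _ _ h1
  rw [Finset.card_range, nsmul_eq_mul] at h2
  push_cast at h2
  calc _ ≤ _ := add_le_add h2 h0
    _ = _ := by ring

/-- one-step estimate -/
lemma step_le (h : GoodW n p P) (k M : ℕ) (hk : k + 1 ≤ n) (V : Finset (Fin n)) (hV : V.card ≤ M)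
    {s : ℝ} (hs1 : 1 ≤ s) (hs : s ^ (k+1) = (n:ℝ)^(k+1) * Qj P (k+1))
    (A : Finset (Finset (Fin n))) (hA : SComplex A) (hAV : ∀ a ∈ A, a ⊆ V) :
    ∑ σ ∈ (Finset.univ : Finset (Fin n)).powersetCard (k+1), P (A ∪ σ.powerset)
      ≤ P A * (s ^ (k+1) * (1 / (Nat.factorial (k+1) : ℝ) + (k+1) * 2 ^ M / s)) := by
  have hq : 0 < Qj P (k+1) := by
    have : 0 < (n:ℝ)^(k+1) * Qj P (k+1) := by rw [← hs]; positivity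
    have hn : (0:ℝ) < n := by exact_mod_cast (by omega : 0 < n)
    exact (pos_iff_pos_of_mul_pos this).1 (by positivity)
  have h1 : ∀ σ ∈ (Finset.univ : Finset (Fin n)).powersetCard (k+1), P (A ∪ σ.powerset)
      ≤ P A * Qj P (k+1) * (1 / Qj P (σ ∩ V).card) := by
    intro σ hσ
    have hσc : σ.card = k+1 := (Finset.mem_powersetCard.1 hσ).2
    have hsi := h.si A _ hA (sc_powerset σ)
    rw [h.P_eq σ, hσc] at hsi
    have h2 : P (σ ∩ V).powerset ≤ P (A ∩ σ.powerset) := by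
      refine h.P_anti fun a ha => ?_
      rw [Finset.mem_inter, Finset.mem_powerset] at ha
      rw [Finset.mem_powerset]
      exact Finset.subset_inter ha.2 (hAV a ha.1)
    rw [h.P_eq] at h2
    have hQ : 0 < Qj P (σ ∩ V).card := hq.trans_le (h.Q_anti
      (hσc ▸ Finset.card_le_card Finset.inter_subset_left))
    rw [mul_one_div, le_div_iff₀ hQ, ← hsi]
    exact mul_le_mul_of_nonneg_left h2 (h.P_nonneg _)
  refine (Finset.sum_le_sum h1).trans ?_
  rw [← Finset.mul_sum, hs]
  calc _ ≤ P A * Qj P (k+1) * _ := mul_le_mul_of_nonneg_left (h.sum_inv_le k M hk V hV hs1 hs)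
        (mul_nonneg (h.P_nonneg _) hq.le)
    _ = _ := by ring

lemma scount_eq (Y : Finset (Finset (Fin n))) (m : ℕ) :
    (scount Y m : ℝ) = ∑ σ ∈ (Finset.univ : Finset (Fin n)).powersetCard m, if σ ∈ Y then (1:ℝ) else 0 := by
  rw [Finset.sum_boole]
  unfold scount
  congr 2
  ext σ; simp [and_comm]

lemma T_le (h : GoodW n p P) (k M : ℕ) (hk : k + 1 ≤ n)
    {s : ℝ} (hs1 : 1 ≤ s) (hs : s ^ (k+1) = (n:ℝ)^(k+1) * Qj P (k+1)) (m : ℕ) :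
    ∀ (V : Finset (Fin n)) (A : Finset (Finset (Fin n))), V.card + m * (k+1) ≤ M →
    SComplex A → (∀ a ∈ A, a ⊆ V) →
    ∑ Y, (if A ⊆ Y then p Y else 0) * (scount Y (k+1) : ℝ)^m ≤
      P A * (s ^ (k+1) * (1 / (Nat.factorial (k+1) : ℝ) + (k+1) * 2 ^ M / s)) ^ m := by
  induction m with
  | zero => intro V A _ _ _; simp [h.hP]
  | succ m ih =>
    intro V A hV hA hAV
    set B := s ^ (k+1) * (1 / (Nat.factorial (k+1) : ℝ) + (k+1) * 2 ^ M / s) with hB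
    have hB0 : 0 ≤ B := by positivity
    have e : ∑ Y, (if A ⊆ Y then p Y else 0) * (scount Y (k+1) : ℝ)^(m+1)
        = ∑ σ ∈ (Finset.univ : Finset (Fin n)).powersetCard (k+1),
          ∑ Y, (if A ∪ σ.powerset ⊆ Y then p Y else 0) * (scount Y (k+1) : ℝ)^m := by
      rw [Finset.sum_comm]
      refine Finset.sum_congr rfl fun Y _ => ?_
      rw [← Finset.sum_mul, pow_succ', ← mul_assoc]
      congr 1
      rw [scount_eq, Finset.mul_sum]
      refine Finset.sum_congr rfl fun σ _ => ?_
      by_cases hY : SComplex Y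
      · simp only [Finset.union_subset_iff, sub_iff hY]
        split_ifs <;> simp_all
      · simp [h.supp Y hY]
    rw [e]
    calc _ ≤ ∑ σ ∈ (Finset.univ : Finset (Fin n)).powersetCard (k+1), P (A ∪ σ.powerset) * B ^ m := by
          refine Finset.sum_le_sum fun σ hσ => ?_
          refine ih (V ∪ σ) _ ?_ (sc_union hA (sc_powerset σ)) ?_
          · have := Finset.card_union_le V σ
            have hσc : σ.card = k+1 := (Finset.mem_powersetCard.1 hσ).2
            rw [add_mul] at hV
            omega
          · intro a ha
            rcases Finset.mem_union.1 ha with ha | ha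
            · exact (hAV a ha).trans Finset.subset_union_left
            · exact (Finset.mem_powerset.1 ha).trans Finset.subset_union_right
      _ ≤ (P A * B) * B ^ m := by
          rw [← Finset.sum_mul]
          refine mul_le_mul_of_nonneg_right ?_ (pow_nonneg hB0 m)
          exact h.step_le k M hk V (by omega) hs1 hs A hA hAV
      _ = _ := by ring

lemma moment_le (h : GoodW n p P) (k m : ℕ) (hk : k + 1 ≤ n)
    {s : ℝ} (hs1 : 1 ≤ s) (hs : s ^ (k+1) = (n:ℝ)^(k+1) * Qj P (k+1)) :
    ∑ Y, p Y * ((scount Y (k+1) : ℝ) / s ^ (k+1)) ^ m ≤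
      (1 / (Nat.factorial (k+1) : ℝ) + (k+1) * 2 ^ (m * (k+1)) / s) ^ m := by
  have h1 := h.T_le k (m * (k+1)) hk hs1 hs m ∅ (Finset.powerset ∅) (by simp) (sc_powerset _) (by simp)
  rw [h.P_empty, one_mul, mul_pow] at h1
  have hs0 : 0 < (s ^ (k+1)) ^ m := by positivity
  rw [← div_le_iff₀' hs0, Finset.sum_div] at h1
  refine le_trans (le_of_eq ?_) h1
  refine Finset.sum_congr rfl fun Y _ => ?_
  by_cases hY : SComplex Y
  · rw [if_pos ((sub_iff hY _).2 hY.1), div_pow, mul_div_assoc]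
  · simp [h.supp Y hY]

lemma mean_eq (h : GoodW n p P) (k : ℕ) :
    ∑ Y, p Y * (scount Y (k+1) : ℝ) = n.choose (k+1) * Qj P (k+1) := by
  simp only [scount_eq, Finset.mul_sum]
  rw [Finset.sum_comm]
  have : ∀ σ ∈ (Finset.univ : Finset (Fin n)).powersetCard (k+1),
      ∑ Y, p Y * (if σ ∈ Y then (1:ℝ) else 0) = Qj P (k+1) := by
    intro σ hσ
    rw [← (Finset.mem_powersetCard.1 hσ).2, ← h.P_eq, h.hP]
    refine Finset.sum_congr rfl fun Y _ => ?_
    by_cases hY : SComplex Y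
    · simp only [sub_iff hY]; split_ifs <;> simp
    · simp [h.supp Y hY]
  rw [Finset.sum_congr rfl this, Finset.sum_const, Finset.card_powersetCard]
  simp

lemma moment_ge (h : GoodW n p P) (k m : ℕ) (hk : k + 1 ≤ n)
    {s : ℝ} (hs1 : 1 ≤ s) (hs : s ^ (k+1) = (n:ℝ)^(k+1) * Qj P (k+1)) :
    ((n.choose (k+1) : ℝ) / (n:ℝ)^(k+1)) ^ m ≤
    ∑ Y, p Y * ((scount Y (k+1) : ℝ) / s ^ (k+1)) ^ m := by
  have hj := Real.pow_arith_mean_le_arith_mean_pow Finset.univ p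
    (fun Y => (scount Y (k+1) : ℝ) / s ^ (k+1)) (fun Y _ => h.nonneg Y) h.sum_one
    (fun Y _ => by positivity) m
  refine le_trans (le_of_eq ?_) hj
  congr 1
  simp only [← mul_div_assoc]
  rw [← Finset.sum_div, h.mean_eq, hs]
  have : Qj P (k+1) ≠ 0 := by
    intro h0
    rw [h0, mul_zero] at hs
    have : 0 < s ^ (k+1) := by positivity
    linarith
  field_simp

end GoodW

lemma integral_fin {n : ℕ} {Ω : Type} [MeasurableSpace Ω] (μ : Measure Ω) [IsProbabilityMeasure μ]
    (X : Ω → Finset (Finset (Fin n))) (hmeas : ∀ Y, MeasurableSet {ω | X ω = Y})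
    (g : Finset (Finset (Fin n)) → ℝ) :
    ∫ ω, g (X ω) ∂μ = ∑ Y, prb μ {ω | X ω = Y} * g Y := by
  have e : (fun ω => g (X ω)) = fun ω => ∑ Y, ({ω | X ω = Y} : Set Ω).indicator (fun _ => g Y) ω := by
    funext ω
    simp [Set.indicator_apply]
  rw [e, integral_finsetSum]
  · refine Finset.sum_congr rfl fun Y _ => ?_
    rw [integral_indicator_const _ (hmeas Y)]
    rfl
  · intro Y _
    exact (integrable_const _).indicator (hmeas Y)

lemma meas_fin {n : ℕ} {Ω : Type} [MeasurableSpace Ω]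
    (X : Ω → Finset (Finset (Fin n))) (hmeas : ∀ Y, MeasurableSet {ω | X ω = Y})
    (D : Finset (Finset (Fin n)) → Prop) : MeasurableSet {ω | D (X ω)} := by
  have : {ω | D (X ω)} = ⋃ Y ∈ {Y | D Y}, {ω | X ω = Y} := by
    ext ω; simp
  rw [this]
  exact MeasurableSet.biUnion (Set.to_countable _) fun Y _ => hmeas Y

lemma prb_fin {n : ℕ} {Ω : Type} [MeasurableSpace Ω] (μ : Measure Ω) [IsProbabilityMeasure μ]
    (X : Ω → Finset (Finset (Fin n))) (hmeas : ∀ Y, MeasurableSet {ω | X ω = Y})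
    (D : Finset (Finset (Fin n)) → Prop) [DecidablePred D] :
    prb μ {ω | D (X ω)} = ∑ Y, if D Y then prb μ {ω | X ω = Y} else 0 := by
  have h := integral_fin μ X hmeas (fun Y => if D Y then 1 else 0)
  have e : (fun ω => if D (X ω) then (1:ℝ) else 0) = ({ω | D (X ω)} : Set Ω).indicator (fun _ => 1) := by
    funext ω; simp [Set.indicator_apply]
  rw [e, integral_indicator_const _ (meas_fin X hmeas D)] at h
  simpa [prb, Measure.real] using h

lemma goodW_mk {n : ℕ} {Ω : Type} [MeasurableSpace Ω] (μ : Measure Ω) [IsProbabilityMeasure μ]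
    (X : Ω → Finset (Finset (Fin n))) (hmeas : ∀ Y, MeasurableSet {ω | X ω = Y})
    (hXc : ∀ ω, SComplex (X ω)) (hhom : Homogeneous μ X) (hsi : SpatInd μ X) :
    GoodW n (fun Y => prb μ {ω | X ω = Y}) (fun A => prb μ {ω | A ⊆ X ω}) where
  nonneg Y := ENNReal.toReal_nonneg
  sum_one := by
    have := integral_fin μ X hmeas (fun _ => 1)
    simpa using this.symm
  supp Y hY := by
    have : {ω | X ω = Y} = ∅ := by
      ext ω; simp; rintro rfl; exact hY (hXc ω)
    simp [this, prb]
  hom g Y := by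
    have hi := Finset.image_injective (Finset.image_injective g.injective)
    rw [← hhom g]
    congr 1
    ext ω
    exact hi.eq_iff
  hP A := prb_fin μ X hmeas (fun Y => A ⊆ Y)
  si A B hA hB := hsi A B hA hB

lemma qpar_eq {n : ℕ} {Ω : Type} [MeasurableSpace Ω] (μ : Measure Ω)
    (X : Ω → Finset (Finset (Fin n))) (hXc : ∀ ω, SComplex (X ω)) (k : ℕ) :
    qpar μ X (k : ℤ) = GoodW.Qj (fun A => prb μ {ω | A ⊆ X ω}) (k+1) := by
  unfold qpar GoodW.Qj
  rw [if_neg (by omega)]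
  congr 1
  ext ω
  simp [GoodW.sub_iff (hXc ω)]

lemma choose_tendsto (k : ℕ) :
    Tendsto (fun n : ℕ => (n.choose k : ℝ) / (n:ℝ)^k) atTop (nhds (1 / (Nat.factorial k : ℝ))) := by
  have h := ProbabilityTheory.tendsto_choose_mul_pow_atTop (p := fun n : ℕ => 1 / (n:ℝ)) (r := 1) k ?_
  · simpa [div_eq_mul_inv] using h
  · refine tendsto_const_nhds.congr' ?_
    filter_upwards [eventually_gt_atTop 0] with n hn
    have : (n:ℝ) ≠ 0 := by positivity
    field_simp

/-- deterministic-limit core: all moments converge. -/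
lemma moments_tendsto (k : ℕ) (p P : ∀ n, Finset (Finset (Fin n)) → ℝ) (h : ∀ n, GoodW n (p n) (P n))
    (hq : Tendsto (fun n : ℕ => (n : ℝ) ^ (k + 1) * GoodW.Qj (P n) (k+1)) atTop atTop) (m : ℕ) :
    Tendsto (fun n : ℕ => ∑ Y, p n Y * ((scount Y (k+1) : ℝ) /
      ((n : ℝ) ^ (k + 1) * GoodW.Qj (P n) (k+1))) ^ m) atTop
      (nhds ((1 / (Nat.factorial (k+1) : ℝ)) ^ m)) := by
  set L : ℕ → ℝ := fun n => (n : ℝ) ^ (k + 1) * GoodW.Qj (P n) (k+1) with hL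
  set s : ℕ → ℝ := fun n => (L n) ^ ((1:ℝ) / ((k+1 : ℕ) : ℝ)) with hs
  have hst : Tendsto s atTop atTop := (tendsto_rpow_atTop (by positivity)).comp hq
  have hsL : ∀ n, 0 ≤ L n → s n ^ (k+1) = L n := by
    intro n h0
    simp only [hs, one_div]
    exact Real.rpow_inv_natCast_pow h0 (by omega)
  have hup : Tendsto (fun n => (1 / (Nat.factorial (k+1) : ℝ) + (k+1) * 2 ^ (m * (k+1)) / s n) ^ m) atTop
      (nhds ((1 / (Nat.factorial (k+1) : ℝ)) ^ m)) := by
    have := ((tendsto_const_nhds (x := 1 / (Nat.factorial (k+1) : ℝ))).add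
      (hst.const_div_atTop (((k:ℝ)+1) * 2 ^ (m * (k+1))))).pow m
    simpa using this
  have hlo := (choose_tendsto (k+1)).pow m
  refine tendsto_of_tendsto_of_tendsto_of_le_of_le' hlo hup ?_ ?_
  · filter_upwards [eventually_ge_atTop (k+1), hst.eventually_ge_atTop 1, hq.eventually_ge_atTop 0] with n h1 h2 h3
    have e := hsL n h3
    have := (h n).moment_ge k m h1 h2 e
    rw [e] at this
    exact this
  · filter_upwards [eventually_ge_atTop (k+1), hst.eventually_ge_atTop 1, hq.eventually_ge_atTop 0] with n h1 h2 h3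
    have e := hsL n h3
    have := (h n).moment_le k m h1 h2 e
    rw [e] at this
    exact this

lemma Lr_tendsto (c : ℝ) (ι : ℕ → Type) [∀ n, Fintype (ι n)] (p Z : ∀ n, ι n → ℝ)
    (hp : ∀ n i, 0 ≤ p n i) (hp1 : ∀ n, ∑ i, p n i = 1)
    (h : ∀ m : ℕ, Tendsto (fun n => ∑ i, p n i * Z n i ^ m) atTop (nhds (c ^ m)))
    (r : ℝ) (hr : 1 ≤ r) :
    Tendsto (fun n => ∑ i, p n i * |Z n i - c| ^ r) atTop (nhds 0) := by
  obtain ⟨m, hm⟩ := exists_nat_ge r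
  set N : ℕ := 2 * m with hN
  have hmpos : (1:ℝ) ≤ m := hr.trans hm
  have hNr : r ≤ (N:ℝ) := by rw [hN]; push_cast; linarith
  have hN0 : N ≠ 0 := by
    rintro h0
    rw [h0] at hNr
    norm_num at hNr
    linarith
  have hr0 : 0 < r := by linarith
  have h1 : Tendsto (fun n => ∑ i, p n i * (Z n i - c) ^ N) atTop (nhds 0) := by
    have e : ∀ n, ∑ i, p n i * (Z n i - c) ^ N = ∑ j ∈ Finset.range (N+1),
        (∑ i, p n i * Z n i ^ j) * ((-c) ^ (N - j) * (N.choose j : ℝ)) := by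
      intro n
      simp only [Finset.sum_mul]
      rw [Finset.sum_comm]
      refine Finset.sum_congr rfl fun i _ => ?_
      rw [sub_eq_add_neg, add_pow, Finset.mul_sum]
      refine Finset.sum_congr rfl fun j _ => ?_
      ring
    simp only [e]
    have := tendsto_finsetSum (Finset.range (N+1)) (fun j _ => (h j).mul_const ((-c) ^ (N - j) * (N.choose j : ℝ)))
    convert this using 2
    have e2 := add_pow c (-c) N
    rw [add_neg_cancel, zero_pow hN0] at e2
    rw [e2]
    exact Finset.sum_congr rfl fun j _ => by ring
  have h2 : Tendsto (fun n => (∑ i, p n i * (Z n i - c) ^ N) ^ (1 / ((N:ℝ) / r))) atTop (nhds 0) := by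
    have h3 := h1.rpow_const (p := 1 / ((N:ℝ) / r)) (Or.inr (by positivity))
    rwa [Real.zero_rpow (by positivity)] at h3
  refine squeeze_zero (fun n => Finset.sum_nonneg fun i _ => mul_nonneg (hp n i) (by positivity)) (fun n => ?_) h2
  have := Real.arith_mean_le_rpow_mean Finset.univ (p n) (fun i => |Z n i - c| ^ r) (fun i _ => hp n i) (hp1 n)
    (fun i _ => by positivity) (p := (N:ℝ)/r) ((one_le_div hr0).2 hNr)
  refine this.trans (le_of_eq ?_)
  congr 1
  refine Finset.sum_congr rfl fun i _ => ?_
  rw [← Real.rpow_mul (abs_nonneg _), mul_div_cancel₀ _ hr0.ne', Real.rpow_natCast,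
    Even.pow_abs (by simp [hN])]

/-- law of large numbers for the number of `k`-simplices:
if `n^{k+1} q_k^{(n)} → ∞` then `f_k(X_n)/(n^{k+1} q_k^{(n)}) → 1/(k+1)!` in every
`L^r`, and in particular `P(f_k(X_n) > 0) → 1`. -/
theorem numFaces_lln (k : ℕ) (Ω : ℕ → Type) [∀ n, MeasurableSpace (Ω n)]
    (μ : ∀ n, Measure (Ω n)) (hprob : ∀ n, IsProbabilityMeasure (μ n))
    (X : ∀ n, Ω n → Finset (Finset (Fin n)))
    (hmeas : ∀ n Y, MeasurableSet {ω | X n ω = Y})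
    (hXc : ∀ n ω, SComplex (X n ω))
    (hhom : ∀ n, Homogeneous (μ n) (X n)) (hsi : ∀ n, SpatInd (μ n) (X n))
    (hq : Tendsto (fun n : ℕ => (n : ℝ) ^ (k + 1) * qpar (μ n) (X n) (k : ℤ))
      atTop atTop) :
    (∀ r : ℝ, 1 ≤ r →
      Tendsto (fun n : ℕ =>
          ∫ ω, |(scount (X n ω) (k + 1) : ℝ) / ((n : ℝ) ^ (k + 1) * qpar (μ n) (X n) (k : ℤ))
            - 1 / (Nat.factorial (k + 1) : ℝ)| ^ r ∂(μ n))
        atTop (nhds 0)) ∧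
    Tendsto (fun n : ℕ => prb (μ n) {ω | 0 < scount (X n ω) (k + 1)}) atTop (nhds 1) := by
  have hG : ∀ n, GoodW n (fun Y => prb (μ n) {ω | X n ω = Y}) (fun A => prb (μ n) {ω | A ⊆ X n ω}) :=
    fun n => goodW_mk (μ n) (X n) (hmeas n) (hXc n) (hhom n) (hsi n)
  have hqe : ∀ n, qpar (μ n) (X n) (k : ℤ)
      = GoodW.Qj (fun A => prb (μ n) {ω | A ⊆ X n ω}) (k+1) := fun n => qpar_eq (μ n) (X n) (hXc n) k
  have main : ∀ r : ℝ, 1 ≤ r →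
      Tendsto (fun n : ℕ => ∑ Y, prb (μ n) {ω | X n ω = Y} *
          |(scount Y (k + 1) : ℝ) / ((n : ℝ) ^ (k + 1) * qpar (μ n) (X n) (k : ℤ))
            - 1 / (Nat.factorial (k + 1) : ℝ)| ^ r) atTop (nhds 0) := by
    intro r hr
    simp only [hqe] at hq ⊢
    exact Lr_tendsto (1 / (Nat.factorial (k + 1) : ℝ)) (fun n => Finset (Finset (Fin n))) _ _
      (fun n => (hG n).nonneg) (fun n => (hG n).sum_one)
      (fun m => moments_tendsto k _ _ hG hq m) r hr
  refine ⟨fun r hr => (main r hr).congr fun n => ?_, ?_⟩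
  · exact (integral_fin (μ n) (X n) (hmeas n) (fun Y =>
      |(scount Y (k + 1) : ℝ) / ((n : ℝ) ^ (k + 1) * qpar (μ n) (X n) (k : ℤ))
            - 1 / (Nat.factorial (k + 1) : ℝ)| ^ r)).symm
  · have hc : (0:ℝ) < 1 / (Nat.factorial (k + 1) : ℝ) := by positivity
    have h1 := main 1 le_rfl
    simp only [Real.rpow_one] at h1
    have h2 := (tendsto_const_nhds (x := (1:ℝ))).sub (h1.div_const (1 / (Nat.factorial (k + 1) : ℝ)))
    rw [zero_div, sub_zero] at h2
    refine tendsto_of_tendsto_of_tendsto_of_le_of_le h2 tendsto_const_nhds (fun n => ?_) (fun n => ?_)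
    · simp only
      rw [prb_fin (μ n) (X n) (hmeas n) (fun Y => 0 < scount Y (k+1)), sub_le_iff_le_add]
      refine (hG n).sum_one.symm.le.trans ?_
      rw [Finset.sum_div, ← Finset.sum_add_distrib]
      refine Finset.sum_le_sum fun Y _ => ?_
      have hp := (hG n).nonneg Y
      split_ifs with hY
      · have : 0 ≤ prb (μ n) {ω | X n ω = Y} * |(scount Y (k + 1) : ℝ) / ((n : ℝ) ^ (k + 1) * qpar (μ n) (X n) (k : ℤ))
            - 1 / (Nat.factorial (k + 1) : ℝ)| / (1 / (Nat.factorial (k + 1) : ℝ)) := by positivity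
        linarith
      · have h0 : scount Y (k+1) = 0 := by omega
        rw [h0, Nat.cast_zero, zero_div, zero_sub, abs_neg, abs_of_pos hc, mul_div_assoc, div_self hc.ne']
        simp
    · exact ENNReal.toReal_le_of_le_ofReal zero_le_one (by simpa using prob_le_one)
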